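/- Let Delta, Delta', Delta'' be integer convex polytopes, and in P(Delta) x (C*)^2 x P(Delta') x P(Delta'') consider the algebraic variety S defined by the equations P(t) = 0, dP/dx(t) = 0, dP/dy(t) = 0, Q(t) = 0, R(t) = 0. Let (P_0, Q_0, R_0) be such that t_0 in (C*)^2 is an ordinary quadratic point of {P_0=0} and the curves {Q_0=0} and {R_0=0} intersect transversely at t_0. Then there is a neighborhood U of (P_0, t_0, Q_0, R_0) such that S cap U is smooth of codimension 5, and the image S' of S cap U under the projection forgetting the (C*)^2 factor is smooth of codimension 3 in P(Delta) x P(Delta') x P(Delta''). -/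

import Mathlib

open MvPolynomial

/-- The coefficient space of polynomials with monomials in the finite lattice set `L`:
this is the space `P(Δ)` of polynomials with Newton polytope (contained in) `Δ`,
coordinatized by coefficients. -/
abbrev Coef (L : Finset (ℕ × ℕ)) : Type := {p : ℕ × ℕ // p ∈ L} → ℂ

/-- The polynomial with coefficient vector `c`. -/
noncomputable def toPoly {L : Finset (ℕ × ℕ)} (c : Coef L) : MvPolynomial (Fin 2) ℂ :=
  ∑ p : {p : ℕ × ℕ // p ∈ L},
    monomial (Finsupp.single 0 p.1.1 + Finsupp.single 1 p.1.2) (c p)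

/-- `z ∈ (ℂ*)²` is a singular point of the curve `{f = 0}`. -/
def IsSingAt (f : MvPolynomial (Fin 2) ℂ) (z : Fin 2 → ℂ) : Prop :=
  z 0 ≠ 0 ∧ z 1 ≠ 0 ∧ eval z f = 0 ∧
    eval z (pderiv 0 f) = 0 ∧ eval z (pderiv 1 f) = 0

/-- `z ∈ (ℂ*)²` is a nondegenerate double point (ordinary quadratic point, node)
of the curve `{f = 0}`. -/
def IsNodeAt (f : MvPolynomial (Fin 2) ℂ) (z : Fin 2 → ℂ) : Prop :=
  IsSingAt f z ∧
    eval z (pderiv 0 (pderiv 0 f)) * eval z (pderiv 1 (pderiv 1 f)) -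
      eval z (pderiv 0 (pderiv 1 f)) * eval z (pderiv 1 (pderiv 0 f)) ≠ 0

def toR (p : ℕ × ℕ) : ℝ × ℝ := ((p.1 : ℝ), (p.2 : ℝ))

/-- The convex hull of the lattice set `L`. -/
def hullOf (L : Finset (ℕ × ℕ)) : Set (ℝ × ℝ) := convexHull ℝ (toR '' L)

/-- `L` is exactly the set of lattice points of the integer convex polytope `conv L`. -/
def IsLatticePolytopeSet (L : Finset (ℕ × ℕ)) : Prop :=
  ∀ p : ℕ × ℕ, toR p ∈ hullOf L ↔ p ∈ L

/-- `b(Δ)`: the number of lattice points on the boundary of the polytope. -/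
noncomputable def boundaryLatticeCount (L : Finset (ℕ × ℕ)) : ℕ :=
  Set.ncard {p : ℕ × ℕ | toR p ∈ frontier (hullOf L)}

open Filter Topology

/-- The derivative of a polynomial function is given by its formal partial derivatives. -/
theorem MvPolynomial.hasFDerivAt_eval {𝕜 σ : Type*} [NontriviallyNormedField 𝕜] [Fintype σ]
    (f : MvPolynomial σ 𝕜) (t : σ → 𝕜) :
    HasFDerivAt (fun x : σ → 𝕜 => eval x f)
      (∑ i, eval t (pderiv i f) • ContinuousLinearMap.proj (R := 𝕜) (φ := fun _ : σ => 𝕜) i) t := by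
  classical
  induction f using MvPolynomial.induction_on with
  | C a =>
    simp only [eval_C]
    refine (hasFDerivAt_const (𝕜 := 𝕜) a t).congr_fderiv ?_
    ext v
    simp
  | add p q hp hq =>
    simp only [map_add]
    refine (hp.fun_add hq).congr_fderiv ?_
    ext v
    simp [add_mul, Finset.sum_add_distrib]
  | mul_X p j hp =>
    have hX := (ContinuousLinearMap.proj (R := 𝕜) (φ := fun _ : σ => 𝕜) j).hasFDerivAt (x := t)
    simp only [map_mul, eval_X]
    refine (hp.mul hX).congr_fderiv ?_
    ext v
    simp [pderiv_X, Pi.single_apply, Finset.sum_add_distrib, add_mul, Finset.mul_sum,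
      apply_ite (eval t), mul_assoc]

/-- `toPoly` as a linear map. -/
noncomputable def toPolyLinear (L : Finset (ℕ × ℕ)) : Coef L →ₗ[ℂ] MvPolynomial (Fin 2) ℂ :=
  ∑ p : {p : ℕ × ℕ // p ∈ L},
    (monomial (Finsupp.single 0 p.1.1 + Finsupp.single 1 p.1.2)).comp (LinearMap.proj p)

theorem toPolyLinear_apply {L : Finset (ℕ × ℕ)} (c : Coef L) : toPolyLinear L c = toPoly c := by
  simp [toPolyLinear, toPoly]

section LinearFamily

variable {ι σ : Type*} [Fintype ι]

/-- The value of the members of a linear family of polynomials at a fixed point. -/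
noncomputable def evalLinear (Φ : (ι → ℂ) →ₗ[ℂ] MvPolynomial σ ℂ) (t : σ → ℂ) :
    (ι → ℂ) →L[ℂ] ℂ :=
  LinearMap.toContinuousLinearMap ((aeval t).toLinearMap.comp Φ)

theorem evalLinear_apply (Φ : (ι → ℂ) →ₗ[ℂ] MvPolynomial σ ℂ) (t : σ → ℂ) (c : ι → ℂ) :
    evalLinear Φ t c = eval t (Φ c) := by
  simp [evalLinear, aeval_eq_eval]

variable [Fintype σ]

theorem analyticAt_eval_linearFamily (Φ : (ι → ℂ) →ₗ[ℂ] MvPolynomial σ ℂ)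
    (w : (ι → ℂ) × (σ → ℂ)) :
    AnalyticAt ℂ (fun w : (ι → ℂ) × (σ → ℂ) => eval w.2 (Φ w.1)) w := by
  classical
  have key : (fun w : (ι → ℂ) × (σ → ℂ) => eval w.2 (Φ w.1)) =
      fun w => ∑ p, w.1 p * eval w.2 (Φ fun j => if p = j then 1 else 0) := by
    funext w
    rw [Φ.pi_apply_eq_sum_univ w.1]
    simp [smul_eval]
  rw [key]
  refine Finset.analyticAt_fun_sum _ fun p _ => AnalyticAt.mul ?_ ?_
  · exact ((ContinuousLinearMap.proj (R := ℂ) (φ := fun _ : ι => ℂ) p).comp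
      (ContinuousLinearMap.fst ℂ (ι → ℂ) (σ → ℂ))).analyticAt w
  · exact AnalyticAt.comp (g := fun t : σ → ℂ => eval t (Φ fun j => if p = j then 1 else 0))
      (AnalyticOnNhd.eval_mvPolynomial _ _ (Set.mem_univ _)) analyticAt_snd

/-- The derivative of `(c, t) ↦ Φ c (t)` for a linear family `Φ` of polynomials. -/
noncomputable def linearFamilyFDeriv (Φ : (ι → ℂ) →ₗ[ℂ] MvPolynomial σ ℂ)
    (w : (ι → ℂ) × (σ → ℂ)) : (ι → ℂ) × (σ → ℂ) →L[ℂ] ℂ :=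
  (evalLinear Φ w.2).coprod (∑ i, eval w.2 (pderiv i (Φ w.1)) • ContinuousLinearMap.proj i)

theorem linearFamilyFDeriv_apply (Φ : (ι → ℂ) →ₗ[ℂ] MvPolynomial σ ℂ)
    (w v : (ι → ℂ) × (σ → ℂ)) :
    linearFamilyFDeriv Φ w v =
      eval w.2 (Φ v.1) + ∑ i, eval w.2 (pderiv i (Φ w.1)) * v.2 i := by
  simp [linearFamilyFDeriv, evalLinear_apply]

theorem hasFDerivAt_eval_linearFamily (Φ : (ι → ℂ) →ₗ[ℂ] MvPolynomial σ ℂ)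
    (w : (ι → ℂ) × (σ → ℂ)) :
    HasFDerivAt (fun w : (ι → ℂ) × (σ → ℂ) => eval w.2 (Φ w.1)) (linearFamilyFDeriv Φ w) w := by
  have h := (analyticAt_eval_linearFamily Φ w).differentiableAt.hasFDerivAt
  have h₁ : HasFDerivAt (fun c => eval w.2 (Φ c)) _ w.1 :=
    HasFDerivAt.comp w.1 (f := fun c => (c, w.2)) h (hasFDerivAt_prodMk_left w.1 w.2)
  have h₂ : HasFDerivAt (fun t => eval t (Φ w.1)) _ w.2 :=
    HasFDerivAt.comp w.2 (f := fun t => (w.1, t)) h (hasFDerivAt_prodMk_right w.1 w.2)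
  have e₁ := h₁.unique ((evalLinear Φ w.2).hasFDerivAt.congr_of_eventuallyEq
    (.of_forall fun c => (evalLinear_apply Φ w.2 c).symm))
  have e₂ := h₂.unique (hasFDerivAt_eval (Φ w.1) w.2)
  rw [linearFamilyFDeriv, ← e₁, ← e₂]
  refine h.congr_fderiv ?_
  ext v <;> simp

end LinearFamily

/-- A nonempty set of monomials attains every value at a point of the torus. -/
theorem exists_eval_toPoly_eq {L : Finset (ℕ × ℕ)} (hL : L.Nonempty) {t : Fin 2 → ℂ}
    (h0 : t 0 ≠ 0) (h1 : t 1 ≠ 0) (a : ℂ) : ∃ c : Coef L, eval t (toPoly c) = a := by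
  classical
  obtain ⟨p, hp⟩ := hL
  refine ⟨Pi.single ⟨p, hp⟩ (a / (t 0 ^ p.1 * t 1 ^ p.2)), ?_⟩
  rw [toPoly, map_sum, Finset.sum_eq_single ⟨p, hp⟩]
  · simp [eval_monomial, Finsupp.prod_add_index', pow_add, Finsupp.prod_single_index]
    field_simp
  · intro q _ hq
    simp [Pi.single_eq_of_ne hq]
  · simp

theorem nonempty_of_toPoly_ne_zero {L : Finset (ℕ × ℕ)} {c : Coef L} (h : toPoly c ≠ 0) :
    L.Nonempty := by
  by_contra hL
  rw [Finset.not_nonempty_iff_eq_empty] at hL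
  subst hL
  exact h (by simp [toPoly])

/-- Near a node, the critical point of a polynomial is an analytic function of its coefficients. -/
theorem exists_analyticAt_criticalPoint {L : Finset (ℕ × ℕ)} {P0 : Coef L} {t0 : Fin 2 → ℂ}
    (hnode : IsNodeAt (toPoly P0) t0) :
    ∃ τ : Coef L → Fin 2 → ℂ, AnalyticAt ℂ τ P0 ∧ τ P0 = t0 ∧
      ∀ᶠ w in 𝓝 (P0, t0), (eval w.2 (pderiv 0 (toPoly w.1)) = 0 ∧
        eval w.2 (pderiv 1 (toPoly w.1)) = 0) ↔ τ w.1 = w.2 := by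
  obtain ⟨⟨-, -, -, hx, hy⟩, hdet⟩ := hnode
  let Φ : Fin 2 → Coef L →ₗ[ℂ] MvPolynomial (Fin 2) ℂ := fun i =>
    (pderiv i : Derivation ℂ (MvPolynomial (Fin 2) ℂ) _).toLinearMap.comp (toPolyLinear L)
  have hΦ (i c) : Φ i c = pderiv i (toPoly c) := by simp [Φ, toPolyLinear_apply]
  have hz : toPoly (0 : Coef L) = 0 := by simp [toPoly]
  let G : Coef L × (Fin 2 → ℂ) → Fin 2 → ℂ := fun w i => eval w.2 (Φ i w.1)
  have hG : ContDiffAt ℂ ⊤ G (P0, t0) :=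
    (analyticAt_pi_iff.2 fun i => analyticAt_eval_linearFamily (Φ i) _).contDiffAt
  have hG' : HasFDerivAt G (ContinuousLinearMap.pi fun i => linearFamilyFDeriv (Φ i) (P0, t0))
      (P0, t0) := hasFDerivAt_pi.2 fun i => hasFDerivAt_eval_linearFamily (Φ i) _
  have hinj : Function.Injective (fderiv ℂ G (P0, t0) ∘L .inr ℂ (Coef L) (Fin 2 → ℂ)) := by
    rw [injective_iff_map_eq_zero]
    intro v hv
    rw [hG'.fderiv] at hv
    have h0 := congrFun hv 0
    have h1 := congrFun hv 1
    simp [linearFamilyFDeriv_apply, hΦ, hz, Fin.sum_univ_two] at h0 h1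
    ext i
    refine (mul_eq_zero.1 (?_ : _ * v i = 0)).resolve_left hdet
    fin_cases i
    · simp only [Fin.zero_eta]
      linear_combination (eval t0 (pderiv 1 (pderiv 1 (toPoly P0)))) * h0 -
        (eval t0 (pderiv 1 (pderiv 0 (toPoly P0)))) * h1
    · simp only [Fin.mk_one]
      linear_combination (eval t0 (pderiv 0 (pderiv 0 (toPoly P0)))) * h1 -
        (eval t0 (pderiv 0 (pderiv 1 (toPoly P0)))) * h0
  have hinv : (fderiv ℂ G (P0, t0) ∘L .inr ℂ (Coef L) (Fin 2 → ℂ)).IsInvertible :=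
    ⟨(LinearEquiv.ofInjectiveEndo _ hinj).toContinuousLinearEquiv, by ext; rfl⟩
  have hG0 : G (P0, t0) = 0 := by
    ext i
    fin_cases i <;> simp [G, hΦ, hx, hy]
  refine ⟨hG.implicitFunction (by simp) hinv, ?_, hG.implicitFunction_apply_self _ hinv, ?_⟩
  · exact (hG.contDiffAt_implicitFunction (by simp) hinv).analyticAt
  · filter_upwards [hG.eventually_apply_eq_iff_implicitFunction (by simp) hinv] with w hw
    rw [← hw, hG0, _root_.funext_iff, Fin.forall_fin_two]
    simp [G, hΦ]

section Projection

variable {L L' L'' : Finset (ℕ × ℕ)} (τ : Coef L → Fin 2 → ℂ)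

/-- The values of `P`, `Q`, `R` at the point `τ P`. -/
noncomputable def valuesAlong (y : Coef L × Coef L' × Coef L'') : Fin 3 → ℂ :=
  ![eval (τ y.1) (toPoly y.1), eval (τ y.1) (toPoly y.2.1), eval (τ y.1) (toPoly y.2.2)]

variable {τ}

theorem analyticAt_valuesAlong {y : Coef L × Coef L' × Coef L''} (hτ : AnalyticAt ℂ τ y.1) :
    AnalyticAt ℂ (valuesAlong τ) y := by
  have hτ' : AnalyticAt ℂ (fun y : Coef L × Coef L' × Coef L'' => τ y.1) y :=
    hτ.comp analyticAt_fst
  have h {M : Finset (ℕ × ℕ)} {g : Coef L × Coef L' × Coef L'' → Coef M}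
      (hg : AnalyticAt ℂ g y) : AnalyticAt ℂ (fun y => eval (τ y.1) (toPoly (g y))) y := by
    have := (analyticAt_eval_linearFamily (toPolyLinear M) (g y, τ y.1)).comp₂ hg hτ'
    simpa only [toPolyLinear_apply] using this
  refine analyticAt_pi_iff.2 fun i => ?_
  fin_cases i
  · exact h analyticAt_fst
  · exact h (analyticAt_fst.comp analyticAt_snd)
  · exact h (analyticAt_snd.comp analyticAt_snd)

theorem surjective_fderiv_valuesAlong {y : Coef L × Coef L' × Coef L''}
    (hτ : DifferentiableAt ℂ τ y.1) (hL : L.Nonempty) (hL' : L'.Nonempty) (hL'' : L''.Nonempty)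
    (h0 : τ y.1 0 ≠ 0) (h1 : τ y.1 1 ≠ 0)
    (hcrit : ∀ i, eval (τ y.1) (pderiv i (toPoly y.1)) = 0) :
    Function.Surjective (fderiv ℂ (valuesAlong τ) y) := by
  let E := Coef L × Coef L' × Coef L''
  let T : E →L[ℂ] (Fin 2 → ℂ) := fderiv ℂ τ y.1 ∘L .fst ℂ _ _
  have hτ' : HasFDerivAt (fun y : E => τ y.1) T y := hτ.hasFDerivAt.comp y hasFDerivAt_fst
  have h {M : Finset (ℕ × ℕ)} (g : E →L[ℂ] Coef M) :
      HasFDerivAt (fun y => eval (τ y.1) (toPoly (g y)))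
        (linearFamilyFDeriv (toPolyLinear M) (g y, τ y.1) ∘L g.prod T) y := by
    have := (hasFDerivAt_eval_linearFamily (toPolyLinear M) (g y, τ y.1)).comp y
      (g.hasFDerivAt.prodMk hτ')
    simpa only [toPolyLinear_apply, Function.comp_def] using this
  have hψ : HasFDerivAt (valuesAlong τ) (ContinuousLinearMap.pi ![
      linearFamilyFDeriv (toPolyLinear L) (y.1, τ y.1) ∘L
        (ContinuousLinearMap.fst ℂ _ _).prod T,
      linearFamilyFDeriv (toPolyLinear L') (y.2.1, τ y.1) ∘L
        (ContinuousLinearMap.fst ℂ _ _ ∘L .snd ℂ _ _).prod T,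
      linearFamilyFDeriv (toPolyLinear L'') (y.2.2, τ y.1) ∘L
        (ContinuousLinearMap.snd ℂ _ _ ∘L .snd ℂ _ _).prod T]) y := by
    refine hasFDerivAt_pi.2 fun i => ?_
    fin_cases i
    · exact h (.fst ℂ _ _)
    · exact h (.fst ℂ _ _ ∘L .snd ℂ _ _)
    · exact h (.snd ℂ _ _ ∘L .snd ℂ _ _)
  rw [hψ.fderiv]
  intro z
  obtain ⟨p, hp⟩ := exists_eval_toPoly_eq hL h0 h1 (z 0)
  obtain ⟨q, hq⟩ := exists_eval_toPoly_eq hL' h0 h1 (z 1 -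
    ∑ i, eval (τ y.1) (pderiv i (toPoly y.2.1)) * fderiv ℂ τ y.1 p i)
  obtain ⟨r, hr⟩ := exists_eval_toPoly_eq hL'' h0 h1 (z 2 -
    ∑ i, eval (τ y.1) (pderiv i (toPoly y.2.2)) * fderiv ℂ τ y.1 p i)
  refine ⟨(p, q, r), ?_⟩
  ext i
  fin_cases i
  · simp [linearFamilyFDeriv_apply, toPolyLinear_apply, hcrit, hp]
  · simp [linearFamilyFDeriv_apply, toPolyLinear_apply, hq, T]
  · simp [linearFamilyFDeriv_apply, toPolyLinear_apply, hr, T]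

end Projection

/-- If `ψ` is a submersion at `π w`, then so is `w ↦ (ψ (π w), t - τ P)` at `w = (P, t, Q, R)`. -/
theorem surjective_fderiv_append_graph {E F G : Type*}
    [NormedAddCommGroup E] [NormedSpace ℂ E] [NormedAddCommGroup F] [NormedSpace ℂ F]
    [NormedAddCommGroup G] [NormedSpace ℂ G]
    {τ : E → Fin 2 → ℂ} {ψ : E × F × G → Fin 3 → ℂ} {w : E × (Fin 2 → ℂ) × F × G}
    (hτ : DifferentiableAt ℂ τ w.1) (hψ : DifferentiableAt ℂ ψ (w.1, w.2.2))
    (hs : Function.Surjective (fderiv ℂ ψ (w.1, w.2.2))) :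
    Function.Surjective (fderiv ℂ (fun w : E × (Fin 2 → ℂ) × F × G =>
      (Fin.append (ψ (w.1, w.2.2)) (w.2.1 - τ w.1) : Fin 5 → ℂ)) w) := by
  let X := E × (Fin 2 → ℂ) × F × G
  let π : X →L[ℂ] E × F × G :=
    (ContinuousLinearMap.fst ℂ _ _).prod (ContinuousLinearMap.snd ℂ _ _ ∘L .snd ℂ _ _)
  let A : X →L[ℂ] Fin 3 → ℂ := fderiv ℂ ψ (w.1, w.2.2) ∘L π
  let B : X →L[ℂ] Fin 2 → ℂ :=
    ContinuousLinearMap.fst ℂ _ _ ∘L .snd ℂ _ _ - fderiv ℂ τ w.1 ∘L .fst ℂ _ _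
  have hA : HasFDerivAt (fun w : X => ψ (w.1, w.2.2)) A w :=
    HasFDerivAt.comp w (f := π) hψ.hasFDerivAt π.hasFDerivAt
  have hB : HasFDerivAt (fun w : X => w.2.1 - τ w.1) B w :=
    (ContinuousLinearMap.fst ℂ _ _ ∘L .snd ℂ _ _ : X →L[ℂ] Fin 2 → ℂ).hasFDerivAt.sub
      (hτ.hasFDerivAt.comp w hasFDerivAt_fst)
  have hAB : HasFDerivAt (fun w : X => (Fin.append (ψ (w.1, w.2.2)) (w.2.1 - τ w.1) : Fin 5 → ℂ))
      (ContinuousLinearMap.pi fun i : Fin (3 + 2) =>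
        Fin.append (fun j => ContinuousLinearMap.proj j ∘L A)
          (fun j => ContinuousLinearMap.proj j ∘L B) i) w := by
    refine hasFDerivAt_pi.2 fun i => ?_
    refine Fin.addCases (m := 3) (n := 2) (fun j => ?_) (fun j => ?_) i
    · simpa only [Fin.append_left] using hasFDerivAt_pi'.1 hA j
    · simpa only [Fin.append_right] using hasFDerivAt_pi'.1 hB j
  rw [hAB.fderiv]
  intro z
  obtain ⟨v, hv⟩ := hs fun i => z (Fin.castAdd 2 i)
  refine ⟨(v.1, fderiv ℂ τ w.1 v.1 + fun i => z (Fin.natAdd 3 i), v.2), ?_⟩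
  ext i
  refine Fin.addCases (m := 3) (n := 2) (fun j => ?_) (fun j => ?_) i
  · simpa [A, π] using congrFun hv j
  · simp [B]

/-- Near a point `(P₀, t₀, Q₀, R₀)` where `t₀` is a node of `{P₀=0}`
and `{Q₀=0}`, `{R₀=0}` meet transversely at `t₀`, the variety
`S = {P(t) = ∂P/∂x(t) = ∂P/∂y(t) = Q(t) = R(t) = 0}` is smooth of codimension 5, and its
projection forgetting the `(ℂ*)²`-factor is smooth of codimension 3. -/
theorem variety_S_smooth_and_projection_smooth
    (L L' L'' : Finset (ℕ × ℕ))
    (hL : IsLatticePolytopeSet L) (hL' : IsLatticePolytopeSet L')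
    (hL'' : IsLatticePolytopeSet L'')
    (P0 : Coef L) (Q0 : Coef L') (R0 : Coef L'') (t0 : Fin 2 → ℂ)
    (hnode : IsNodeAt (toPoly P0) t0)
    (hQ0 : eval t0 (toPoly Q0) = 0) (hR0 : eval t0 (toPoly R0) = 0)
    -- `{Q₀=0}` and `{R₀=0}` intersect transversely at `t₀`:
    (htrans : eval t0 (pderiv 0 (toPoly Q0)) * eval t0 (pderiv 1 (toPoly R0)) -
      eval t0 (pderiv 1 (toPoly Q0)) * eval t0 (pderiv 0 (toPoly R0)) ≠ 0)
    (S : Set (Coef L × (Fin 2 → ℂ) × Coef L' × Coef L''))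
    (hS : S = {w | eval w.2.1 (toPoly w.1) = 0 ∧
      eval w.2.1 (pderiv 0 (toPoly w.1)) = 0 ∧
      eval w.2.1 (pderiv 1 (toPoly w.1)) = 0 ∧
      eval w.2.1 (toPoly w.2.2.1) = 0 ∧ eval w.2.1 (toPoly w.2.2.2) = 0}) :
    -- `S ∩ U` is smooth of codimension 5:
    (∃ U : Set (Coef L × (Fin 2 → ℂ) × Coef L' × Coef L''),
      IsOpen U ∧ (P0, t0, Q0, R0) ∈ U ∧
      ∃ φ : (Coef L × (Fin 2 → ℂ) × Coef L' × Coef L'') → (Fin 5 → ℂ),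
        AnalyticOnNhd ℂ φ U ∧
        S ∩ U = {w ∈ U | φ w = 0} ∧
        (∀ w ∈ S ∩ U, Function.Surjective (fderiv ℂ φ w)) ∧
      -- and its image `S' = π(S ∩ U)` is smooth of codimension 3:
      ∃ V : Set (Coef L × Coef L' × Coef L''), IsOpen V ∧ (P0, Q0, R0) ∈ V ∧
        ∃ ψ : (Coef L × Coef L' × Coef L'') → (Fin 3 → ℂ),
          AnalyticOnNhd ℂ ψ V ∧
          (fun w : Coef L × (Fin 2 → ℂ) × Coef L' × Coef L'' =>
              (w.1, w.2.2.1, w.2.2.2)) '' (S ∩ U) = {y ∈ V | ψ y = 0} ∧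
          (∀ y ∈ (fun w : Coef L × (Fin 2 → ℂ) × Coef L' × Coef L'' =>
              (w.1, w.2.2.1, w.2.2.2)) '' (S ∩ U),
            Function.Surjective (fderiv ℂ ψ y))) := by
  obtain ⟨τ, hτ, hτ0, hcrit⟩ := exists_analyticAt_criticalPoint hnode
  have hLne : L.Nonempty := nonempty_of_toPoly_ne_zero (c := P0) fun h => hnode.2 (by simp [h])
  have hLne' : L'.Nonempty := nonempty_of_toPoly_ne_zero (c := Q0) fun h => htrans (by simp [h])
  have hLne'' : L''.Nonempty := nonempty_of_toPoly_ne_zero (c := R0) fun h => htrans (by simp [h])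
  obtain ⟨⟨ht0, ht1, -⟩, -⟩ := hnode
  have htorus : ∀ᶠ w : Coef L × (Fin 2 → ℂ) in 𝓝 (P0, t0), w.2 0 ≠ 0 ∧ w.2 1 ≠ 0 :=
    (ContinuousAt.eventually_ne (g := fun w : Coef L × (Fin 2 → ℂ) => w.2 0)
      (by fun_prop) ht0).and
    (ContinuousAt.eventually_ne (g := fun w : Coef L × (Fin 2 → ℂ) => w.2 1)
      (by fun_prop) ht1)
  obtain ⟨U₀, hU₀, hU₀o, hU₀m⟩ := eventually_nhds_iff.1 (hcrit.and htorus)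
  have hgraph : ∀ᶠ P in 𝓝 P0, (P, τ P) ∈ U₀ :=
    (continuousAt_id.prodMk hτ.continuousAt).eventually_mem (hU₀o.mem_nhds (by simpa [hτ0]))
  obtain ⟨V₀, hV₀, hV₀o, hV₀m⟩ :=
    eventually_nhds_iff.1 (hτ.eventually_analyticAt.and hgraph)
  have hSU (w : Coef L × (Fin 2 → ℂ) × Coef L' × Coef L'') (hw : (w.1, w.2.1) ∈ U₀) :
      w ∈ S ↔ valuesAlong τ (w.1, w.2.2) = 0 ∧ w.2.1 = τ w.1 := by
    have h := (hU₀ _ hw).1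
    simp only at h
    subst hS
    simp only [Set.mem_ofPred_eq, valuesAlong, _root_.funext_iff (α := Fin 3),
      Fin.forall_fin_succ]
    constructor
    · rintro ⟨a, b, c, d, e⟩
      have := h.1 ⟨b, c⟩
      simp [this, a, d, e]
    · rintro ⟨a, b⟩
      have := h.2 b.symm
      simp_all
  have himage : (fun w : Coef L × (Fin 2 → ℂ) × Coef L' × Coef L'' => (w.1, w.2.2.1, w.2.2.2)) ''
      (S ∩ {w | w.1 ∈ V₀ ∧ (w.1, w.2.1) ∈ U₀}) =
      {y ∈ {y | y.1 ∈ V₀} | valuesAlong τ y = 0} := by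
    ext y
    constructor
    · rintro ⟨w, ⟨hw, hwV, hwU⟩, rfl⟩
      exact ⟨hwV, ((hSU w hwU).1 hw).1⟩
    · rintro ⟨hyV, hy⟩
      exact ⟨(y.1, τ y.1, y.2), ⟨(hSU _ (hV₀ _ hyV).2).2 ⟨hy, rfl⟩, hyV, (hV₀ _ hyV).2⟩, rfl⟩
  have hsurj (y : Coef L × Coef L' × Coef L'') (hy : y.1 ∈ V₀) :
      Function.Surjective (fderiv ℂ (valuesAlong τ) y) := by
    obtain ⟨hτy, hyU⟩ := hV₀ _ hy
    obtain ⟨hc, h0, h1⟩ := hU₀ _ hyU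
    exact surjective_fderiv_valuesAlong hτy.differentiableAt hLne hLne' hLne'' h0 h1
      (Fin.forall_fin_two.2 (hc.2 rfl))
  refine ⟨{w | w.1 ∈ V₀ ∧ (w.1, w.2.1) ∈ U₀},
    (hV₀o.preimage continuous_fst).inter (hU₀o.preimage (by fun_prop)), ⟨hV₀m, hU₀m⟩,
    fun w => (Fin.append (valuesAlong τ (w.1, w.2.2)) (w.2.1 - τ w.1) : Fin 5 → ℂ),
    ?_, ?_, ?_, {y | y.1 ∈ V₀}, hV₀o.preimage continuous_fst, hV₀m, valuesAlong τ,
    fun y hy => analyticAt_valuesAlong (hV₀ _ hy).1, himage, ?_⟩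
  · intro w hw
    have hτw := (hV₀ _ hw.1).1
    have hA : AnalyticAt ℂ (fun w : Coef L × (Fin 2 → ℂ) × Coef L' × Coef L'' =>
        valuesAlong τ (w.1, w.2.2)) w :=
      AnalyticAt.fun_comp (analyticAt_valuesAlong (y := (w.1, w.2.2)) hτw)
        (analyticAt_fst.prod (analyticAt_snd.comp analyticAt_snd))
    have hB : AnalyticAt ℂ (fun w : Coef L × (Fin 2 → ℂ) × Coef L' × Coef L'' =>
        w.2.1 - τ w.1) w :=
      (analyticAt_fst.comp analyticAt_snd).sub (hτw.comp analyticAt_fst)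
    refine analyticAt_pi_iff.2 fun i => ?_
    refine Fin.addCases (m := 3) (n := 2) (fun j => ?_) (fun j => ?_) i
    · simpa only [Fin.append_left] using analyticAt_pi_iff.1 hA j
    · simpa only [Fin.append_right] using analyticAt_pi_iff.1 hB j
  · ext w
    rw [Set.inter_comm]
    refine and_congr_right fun hw => (hSU w hw.2).trans ?_
    rw [← sub_eq_zero (a := w.2.1), _root_.funext_iff, _root_.funext_iff, _root_.funext_iff]
    refine Iff.trans ?_ (Fin.forall_fin_add (m := 3) (n := 2) _).symm
    simp only [Fin.append_left, Fin.append_right, Pi.zero_apply]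
  · rintro w ⟨-, hw, -⟩
    have hτw := (hV₀ _ hw).1
    exact surjective_fderiv_append_graph hτw.differentiableAt
      (analyticAt_valuesAlong (y := (w.1, w.2.2)) hτw).differentiableAt (hsurj _ hw)
  · rw [himage]
    exact fun y hy => hsurj y hy.1
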